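/- arXiv:2409.19787 — 5 statements merged into one kernel-verified Lean document; each statement's English description precedes it below -/
import Mathlib

section
/- For every integer k ≥ 1 there exists a constant A₉ > 0, depending only on k, with the following property. Let 0 < r < 1 and ε > 0. Let Q := {z ∈ ℂ^k : |Re z_j| < r and |Im z_j| < r for all j} and Q' := {z ∈ ℂ^k : |Re z_j| < (1−r)r and |Im z_j| < (1−r)r for all j}. Let g : ℂ^k → ℂ^k be holomorphic on Q with g(Q) ⊆ Q' and with the Euclidean diameter of g(Q) at most ε. Then g admits a unique fixed point a in Q; moreover a ∈ Q', the complex derivative satisfies ‖Dg(a)‖ ≤ A₉ ε / r², and for every point a' ∈ Q the sequence of iterates gⁿ(a') converges to a. -/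
open Metric Filter

lemma iter_aux {E : Type*} [NormedAddCommGroup E] [NormedSpace ℂ E] {Q : Set E}
    {g : E → E} (hg : DifferentiableOn ℂ g Q) (hm : Set.MapsTo g Q Q) (n : ℕ) :
    DifferentiableOn ℂ g^[n] Q := by
  induction n with
  | zero => exact differentiableOn_id
  | succ n ih =>
    rw [Function.iterate_succ]
    exact ih.comp hg hm

lemma contr_aux {E : Type*} [NormedAddCommGroup E] [NormedSpace ℂ E] {Q : Set E}
    (hQ : IsOpen Q) {g : E → E} (hg : DifferentiableOn ℂ g Q) (hm : Set.MapsTo g Q Q)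
    {η : ℝ} (hη : 0 < η) (hηm : ∀ y ∈ Q, ∀ z ∈ Q, g z + (η : ℂ) • (g z - g y) ∈ Q)
    {x : E} (hx : x ∈ Q) {B : ℝ}
    (hB : ∀ f : E → E, DifferentiableOn ℂ f Q → Set.MapsTo f Q Q → ‖fderiv ℂ f x‖ ≤ B) (n : ℕ) :
    ∀ f : E → E, DifferentiableOn ℂ f Q → Set.MapsTo f Q Q →
      ‖fderiv ℂ (f ∘ g^[n]) x‖ ≤ B * (1 / (1 + η)) ^ n := by
  induction n with
  | zero => intro f hf hfm; simpa using hB f hf hfm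
  | succ n ih =>
    intro f hf hfm
    set y := g^[n] x with hy
    have hyQ : y ∈ Q := hm.iterate n hx
    set h : E → E := fun z => g z + (η : ℂ) • (g z - g y) with hh
    have hhm : Set.MapsTo h Q Q := fun z hz => hηm y hyQ z hz
    have hhd : DifferentiableOn ℂ h Q := by
      intro z hz
      have := hg z hz
      fun_prop
    have key := ih (f ∘ h) (hf.comp hhd hhm) (hfm.comp hhm)
    have gy : HasFDerivAt g (fderiv ℂ g y) y :=
      (hg.differentiableAt (hQ.mem_nhds hyQ)).hasFDerivAt
    have hhy : h y = g y := by simp [hh]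
    have dh : HasFDerivAt h (fderiv ℂ g y + (η : ℂ) • fderiv ℂ g y) y :=
      gy.add ((gy.sub_const (g y)).const_smul (η : ℂ))
    have df : HasFDerivAt f (fderiv ℂ f (g y)) (g y) :=
      (hf.differentiableAt (hQ.mem_nhds (hm hyQ))).hasFDerivAt
    have di : HasFDerivAt g^[n] (fderiv ℂ g^[n] x) x :=
      ((iter_aux hg hm n).differentiableAt (hQ.mem_nhds hx)).hasFDerivAt
    have d1 : HasFDerivAt (f ∘ g^[n + 1])
        (((fderiv ℂ f (g y)).comp (fderiv ℂ g y)).comp (fderiv ℂ g^[n] x)) x := by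
      rw [Function.iterate_succ', ← Function.comp_assoc]
      exact (df.comp y gy).comp x di
    have d2 : HasFDerivAt ((f ∘ h) ∘ g^[n])
        (((fderiv ℂ f (g y)).comp (fderiv ℂ g y + (η : ℂ) • fderiv ℂ g y)).comp
          (fderiv ℂ g^[n] x)) x := by
      refine HasFDerivAt.comp x ?_ di
      refine HasFDerivAt.comp y ?_ dh
      rw [hhy]; exact df
    have e : fderiv ℂ ((f ∘ h) ∘ g^[n]) x = ((1 + η : ℝ) : ℂ) • fderiv ℂ (f ∘ g^[n + 1]) x := by
      rw [d1.fderiv, d2.fderiv]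
      ext v
      simp [add_smul]
    rw [e, norm_smul, Complex.norm_real, Real.norm_of_nonneg (by positivity)] at key
    rw [pow_succ, ← mul_assoc, mul_one_div, le_div_iff₀ (by positivity)]
    linarith

def cubeAux (k : ℕ) (r : ℝ) : Set (EuclideanSpace ℂ (Fin k)) :=
  {z | ∀ j, |(z j).re| < r ∧ |(z j).im| < r}

lemma cubeAux_isOpen (k : ℕ) (r : ℝ) : IsOpen (cubeAux k r) := by
  simp only [cubeAux, Set.ofPred_forall, Set.ofPred_and]
  refine isOpen_iInter_of_finite fun j => IsOpen.inter ?_ ?_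
  · exact isOpen_lt (by fun_prop) (by fun_prop)
  · exact isOpen_lt (by fun_prop) (by fun_prop)

lemma cubeAux_closure (k : ℕ) {s r : ℝ} (h : s < r) : closure (cubeAux k s) ⊆ cubeAux k r := by
  have hc : IsClosed {z : EuclideanSpace ℂ (Fin k) | ∀ j, |(z j).re| ≤ s ∧ |(z j).im| ≤ s} := by
    simp only [Set.ofPred_forall, Set.ofPred_and]
    refine isClosed_iInter fun j => IsClosed.inter ?_ ?_
    · exact isClosed_le (by fun_prop) (by fun_prop)
    · exact isClosed_le (by fun_prop) (by fun_prop)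
  have hs : cubeAux k s ⊆
      {z : EuclideanSpace ℂ (Fin k) | ∀ j, |(z j).re| ≤ s ∧ |(z j).im| ≤ s} :=
    fun z hz j => ⟨(hz j).1.le, (hz j).2.le⟩
  have := closure_minimal hs hc
  intro z hz j
  exact ⟨(this hz j).1.trans_lt h, (this hz j).2.trans_lt h⟩

lemma cubeAux_convex (k : ℕ) (r : ℝ) : Convex ℝ (cubeAux k r) := by
  intro x hx y hy a b ha hb hab j
  have key : ∀ u v : ℝ, |u| < r → |v| < r → |a * u + b * v| < r := by
    intro u v hu hv
    have := (convex_ball (0 : ℝ) r) (x := u) (by simpa using hu) (y := v) (by simpa using hv)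
      ha hb hab
    simpa using this
  constructor
  · simpa using key _ _ (hx j).1 (hy j).1
  · simpa using key _ _ (hx j).2 (hy j).2

lemma cubeAux_norm (k : ℕ) {r : ℝ} (hr : r < 1) {z : EuclideanSpace ℂ (Fin k)}
    (hz : z ∈ cubeAux k r) : ‖z‖ ≤ k * 2 := by
  have h0 : ∀ j, ‖z j‖ ≤ 2 := fun j => by
    have := Complex.norm_le_abs_re_add_abs_im (z j)
    have := hz j
    linarith
  rw [EuclideanSpace.norm_eq]
  apply Real.sqrt_le_iff.2 ⟨by positivity, ?_⟩
  calc ∑ i, ‖z i‖ ^ 2 ≤ ∑ i : Fin k, (4 : ℝ) := by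
        refine Finset.sum_le_sum fun i _ => ?_
        nlinarith [h0 i, norm_nonneg (z i)]
    _ = k * 4 := by simp
    _ ≤ (k * 2) ^ 2 := by
        have : (k : ℝ) ≤ (k : ℝ) ^ 2 := by exact_mod_cast Nat.le_self_pow two_ne_zero k
        nlinarith

lemma cubeAux_ball (k : ℕ) {r : ℝ} {x : EuclideanSpace ℂ (Fin k)}
    (hx : x ∈ cubeAux k ((1 - r) * r)) : ball x (r ^ 2) ⊆ cubeAux k r := by
  intro z hz j
  rw [mem_ball, dist_eq_norm] at hz
  have h1 : ‖z j - x j‖ < r ^ 2 := lt_of_le_of_lt (PiLp.norm_apply_le (z - x) j) hz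
  have h2 := (Complex.abs_re_le_norm (z j - x j)).trans_lt h1
  have h3 := (Complex.abs_im_le_norm (z j - x j)).trans_lt h1
  have h4 := hx j
  simp only [Complex.sub_re, Complex.sub_im, abs_lt] at h2 h3 h4 ⊢
  refine ⟨⟨?_, ?_⟩, ?_, ?_⟩ <;> nlinarith

lemma main_aux (k : ℕ) (r ε : ℝ) (hr : 0 < r) (hr1 : r < 1)
    (g : EuclideanSpace ℂ (Fin k) → EuclideanSpace ℂ (Fin k))
    (hg : DifferentiableOn ℂ g (cubeAux k r))
    (hgm : g '' cubeAux k r ⊆ cubeAux k ((1 - r) * r))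
    (hd : Metric.diam (g '' cubeAux k r) ≤ ε) :
    ∃ a ∈ cubeAux k r, g a = a ∧ (∀ b ∈ cubeAux k r, g b = b → b = a) ∧
      a ∈ cubeAux k ((1 - r) * r) ∧ ‖fderiv ℂ g a‖ ≤ 1 * ε / r ^ 2 ∧
      (∀ a' ∈ cubeAux k r, Tendsto (fun n => g^[n] a') atTop (nhds a)) := by
  have hlt : (1 - r) * r < r := by nlinarith
  have hm' : Set.MapsTo g (cubeAux k r) (cubeAux k ((1 - r) * r)) := Set.mapsTo_iff_image_subset.2 hgm
  have hsub : cubeAux k ((1 - r) * r) ⊆ cubeAux k r := subset_closure.trans (cubeAux_closure k hlt)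
  have hm : Set.MapsTo g (cubeAux k r) (cubeAux k r) := fun z hz => hsub (hm' hz)
  have hη : ∀ y ∈ cubeAux k r, ∀ z ∈ cubeAux k r,
      g z + ((r / 2 : ℝ) : ℂ) • (g z - g y) ∈ cubeAux k r := by
    intro y hy z hz j
    have key : ∀ u v : ℝ, |u| < (1 - r) * r → |v| < (1 - r) * r →
        |u + r / 2 * (u - v)| < r := by
      intro u v hu hv
      rw [abs_lt] at *
      have e : (1 - r) * r + r / 2 * (2 * ((1 - r) * r)) < r := by nlinarith [pow_pos hr 3]
      constructor <;> nlinarith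
    have h1 := hm' hz j
    have h2 := hm' hy j
    constructor
    · simpa using key _ _ h1.1 h2.1
    · simpa using key _ _ h1.2 h2.2
  set q : ℝ := 1 / (1 + r / 2) with hq
  have hq0 : 0 ≤ q := by positivity
  have hq1 : q < 1 := by rw [hq, div_lt_one (by positivity)]; linarith
  set B : ℝ := (k * 2 + k * 2) / r ^ 2 with hBdef
  have hder : ∀ n, ∀ x ∈ cubeAux k ((1 - r) * r), ‖fderiv ℂ g^[n] x‖ ≤ B * q ^ n := by
    intro n x hx
    refine contr_aux (cubeAux_isOpen k r) hg hm (η := r / 2) (by positivity) hη (hsub hx) (B := B)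
      ?_ n id differentiableOn_id (Set.mapsTo_id _)
    intro f hf hfm
    refine Complex.norm_fderiv_le_div_of_mapsTo_ball (hf.mono (cubeAux_ball k hx)) ?_ (by positivity)
    intro z hz
    rw [mem_closedBall, dist_eq_norm]
    refine (norm_sub_le _ _).trans (add_le_add ?_ ?_)
    · exact cubeAux_norm k hr1 (hfm (cubeAux_ball k hx hz))
    · exact cubeAux_norm k hr1 (hfm (hsub hx))
  have hlip : ∀ n, ∀ x ∈ cubeAux k ((1 - r) * r), ∀ y ∈ cubeAux k ((1 - r) * r),
      dist (g^[n] x) (g^[n] y) ≤ B * dist x y * q ^ n := by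
    intro n x hx y hy
    have := Convex.norm_image_sub_le_of_norm_fderiv_le (𝕜 := ℂ) (f := g^[n]) (fun z hz =>
      (iter_aux hg hm n).differentiableAt ((cubeAux_isOpen k r).mem_nhds (hsub hz)))
      (hder n) (cubeAux_convex k _) hy hx
    rw [dist_eq_norm, dist_eq_norm]
    linarith
  have h0 : (0 : EuclideanSpace ℂ (Fin k)) ∈ cubeAux k r := fun j => by simpa using hr
  have hu : ∀ n, dist (g^[n] (g 0)) (g^[n + 1] (g 0)) ≤ (B * dist (g 0) (g (g 0))) * q ^ n := by
    intro n
    rw [Function.iterate_succ_apply]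
    exact hlip n _ (hm' h0) _ (hm' (hm h0))
  obtain ⟨a, ha⟩ := cauchySeq_tendsto_of_complete (cauchySeq_of_le_geometric q _ hq1 hu)
  have hacl : a ∈ closure (cubeAux k ((1 - r) * r)) := by
    refine mem_closure_of_tendsto ha (Eventually.of_forall fun n => ?_)
    rw [← Function.iterate_succ_apply, Function.iterate_succ_apply']
    exact hm' (hm.iterate n h0)
  have haQ : a ∈ cubeAux k r := cubeAux_closure k hlt hacl
  have hfix : g a = a := isFixedPt_of_tendsto_iterate ha
    (hg.differentiableAt ((cubeAux_isOpen k r).mem_nhds haQ)).continuousAt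
  have haQ' : a ∈ cubeAux k ((1 - r) * r) := hfix ▸ hm' haQ
  have hconv : ∀ a' ∈ cubeAux k r, Tendsto (fun n => g^[n] a') atTop (nhds a) := by
    intro a' ha'
    rw [← tendsto_add_atTop_iff_nat 1, tendsto_iff_dist_tendsto_zero]
    refine squeeze_zero (fun _ => dist_nonneg) (g := fun n => B * dist (g a') a * q ^ n) ?_ ?_
    · intro n
      have := hlip n _ (hm' ha') _ haQ'
      rwa [Function.iterate_fixed hfix, ← Function.iterate_succ_apply] at this
    · simpa using (tendsto_pow_atTop_nhds_zero_of_lt_one hq0 hq1).const_mul (B * dist (g a') a)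
  refine ⟨a, haQ, hfix, ?_, haQ', ?_, hconv⟩
  · intro b hb hgb
    have := hconv b hb
    simp only [Function.iterate_fixed hgb] at this
    exact tendsto_nhds_unique tendsto_const_nhds this
  · rw [one_mul]
    refine Complex.norm_fderiv_le_div_of_mapsTo_ball (hg.mono (cubeAux_ball k haQ')) ?_
      (by positivity)
    intro z hz
    rw [mem_closedBall]
    refine (Metric.dist_le_diam_of_mem ?_ (Set.mem_image_of_mem g (cubeAux_ball k haQ' hz))
      (Set.mem_image_of_mem g haQ)).trans hd
    refine (Metric.isBounded_closedBall (x := 0) (r := (k * 2 : ℝ))).subset ?_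
    rintro _ ⟨w, hw, rfl⟩
    simpa using cubeAux_norm k hr1 (hm hw)


/-- Lemma 5.4: a holomorphic map from the cube `rW^k` into the shrunk cube
`(1-r)rW^k` with image of diameter at most `ε` has a unique, attracting fixed
point, with derivative norm `≤ A₉ ε / r²`, attracting the whole cube. -/
theorem stmt_0 (k : ℕ) (hk : 1 ≤ k) :
    ∃ A : ℝ, 0 < A ∧
      ∀ (r ε : ℝ), 0 < r → r < 1 → 0 < ε →
      ∀ g : EuclideanSpace ℂ (Fin k) → EuclideanSpace ℂ (Fin k),
      DifferentiableOn ℂ g {z | ∀ j, |(z j).re| < r ∧ |(z j).im| < r} →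
      g '' {z | ∀ j, |(z j).re| < r ∧ |(z j).im| < r} ⊆
        {z | ∀ j, |(z j).re| < (1 - r) * r ∧ |(z j).im| < (1 - r) * r} →
      Metric.diam (g '' {z | ∀ j, |(z j).re| < r ∧ |(z j).im| < r}) ≤ ε →
      ∃ a ∈ {z : EuclideanSpace ℂ (Fin k) | ∀ j, |(z j).re| < r ∧ |(z j).im| < r},
        g a = a ∧
        (∀ b ∈ {z : EuclideanSpace ℂ (Fin k) | ∀ j, |(z j).re| < r ∧ |(z j).im| < r},
          g b = b → b = a) ∧
        (∀ j, |(a j).re| < (1 - r) * r ∧ |(a j).im| < (1 - r) * r) ∧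
        ‖fderiv ℂ g a‖ ≤ A * ε / r ^ 2 ∧
        (∀ a' ∈ {z : EuclideanSpace ℂ (Fin k) | ∀ j, |(z j).re| < r ∧ |(z j).im| < r},
          Tendsto (fun n => g^[n] a') atTop (nhds a)) := by
  exact ⟨1, one_pos, fun r ε hr hr1 _ g hg hgm hd => main_aux k r ε hr hr1 g hg hgm hd⟩
end

section
/- Let m ≥ 1 be an integer, 0 < r < 1/100, and τ ∈ ℝ^m. If x ∈ 4S_{r,τ}, that is, for every η ∈ ℤ^m there is an index j with |x_j − τ_j − 2rη_j| ≥ (1−4r)r, then there exist an index j ∈ {1,…,m} and an integer q ∈ ℤ such that |x_j − τ_j − r − 2rq| ≤ 4r². -/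
/-- Geometric step in Lemma 4.1: any point of the extended street network `4S_{r,τ}`
lies in a coordinate slab `{ |x_j - τ_j - r - 2rq| ≤ 4r² }` for some `j` and `q ∈ ℤ`. -/
theorem stmt_3 (m : ℕ) (hm : 1 ≤ m) (r : ℝ) (hr0 : 0 < r) (hr : r < 1 / 100)
    (τ x : Fin m → ℝ)
    (hx : ∀ η : Fin m → ℤ, ∃ j, (1 - 4 * r) * r ≤ |x j - τ j - 2 * r * (η j : ℝ)|) :
    ∃ j : Fin m, ∃ q : ℤ, |x j - τ j - r - 2 * r * (q : ℝ)| ≤ 4 * r ^ 2 := by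
  obtain ⟨j, hj⟩ := hx (fun j => round ((x j - τ j) / (2 * r)))
  have h := abs_le.mp (abs_sub_round ((x j - τ j) / (2 * r)))
  generalize round ((x j - τ j) / (2 * r)) = n at hj h
  obtain ⟨y, hy⟩ : ∃ y, y = (x j - τ j) / (2 * r) := ⟨_, rfl⟩
  have hxy : x j - τ j = 2 * r * y := by rw [hy]; field_simp
  rw [← hy] at h
  rw [hxy] at hj
  obtain ⟨h1, h2⟩ := h
  have h3 : 2 * r * y - 2 * r * n ≤ r := by nlinarith
  have h4 : -r ≤ 2 * r * y - 2 * r * n := by nlinarith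
  refine ⟨j, ?_⟩
  rw [hxy]
  rcases le_abs.mp hj with h5 | h5
  · exact ⟨n, abs_le.mpr ⟨by nlinarith, by nlinarith⟩⟩
  · refine ⟨n - 1, abs_le.mpr ⟨?_, ?_⟩⟩ <;> push_cast <;> nlinarith
end

section
/- For every integer ℓ ≥ 1 there exists a constant c_ℓ > 0 such that for every integer δ ≥ 1 and every nonzero polynomial P in ℓ complex variables of total degree at most δ, there exists a point a in the closed unit polydisc {z ∈ ℂ^ℓ : |z_j| ≤ 1 for all j} such that every zero z ∈ ℂ^ℓ of P satisfies ‖a − z‖ ≥ c_ℓ δ^{−1/2}, where ‖·‖ is the Euclidean norm on ℂ^ℓ. -/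
/-- The Gaussian-weighted modulus of `P`. -/
noncomputable def gaussW {n : ℕ} (δ : ℕ) (P : MvPolynomial (Fin n) ℂ) (z : Fin n → ℂ) : ℝ :=
  ‖MvPolynomial.eval z P‖ * Real.exp (-(δ / 2 : ℝ) * ∑ j, ‖z j‖ ^ 2)

/-- A one-variable polynomial of degree `≤ δ` is controlled outside the disc by the circle. -/
lemma poly_growth (p : Polynomial ℂ) (δ : ℕ) (hp : p.natDegree ≤ δ) (t : ℂ) (ht : 1 < ‖t‖) :
    ∃ s : ℂ, ‖s‖ = 1 ∧ ‖p.eval t‖ ≤ ‖t‖ ^ δ * ‖p.eval s‖ := by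
  have key : ∀ x : ℂ, x ≠ 0 → p.eval x⁻¹ = (x⁻¹) ^ δ * (p.reflect δ).eval x := by
    intro x hx
    let u : ℂˣ := Units.mk0 x hx
    have hi : Invertible x⁻¹ := invertibleOfNonzero (inv_ne_zero hx)
    have h := Polynomial.eval₂_reflect_mul_pow (RingHom.id ℂ) x⁻¹ δ p hp
    have e : ⅟(x⁻¹) = x := by simp
    rw [e] at h
    simp only [Polynomial.eval₂_id] at h
    rw [← h, mul_comm]
  have hne : (Metric.ball (0 : ℂ) 1).Nonempty := ⟨0, by simp⟩
  obtain ⟨z, hz, hmax⟩ := Complex.exists_mem_frontier_isMaxOn_norm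
    (f := fun x => (p.reflect δ).eval x) Metric.isBounded_ball hne
    ((p.reflect δ).differentiable.diffContOnCl)
  rw [frontier_ball (0 : ℂ) one_ne_zero] at hz
  have hz1 : ‖z‖ = 1 := by simpa using hz
  have hz0 : z ≠ 0 := by rintro rfl; simp at hz1
  have ht0 : t ≠ 0 := by rintro rfl; norm_num at ht
  refine ⟨z⁻¹, by simp [hz1], ?_⟩
  have h1 := key t⁻¹ (inv_ne_zero ht0)
  rw [inv_inv] at h1
  rw [h1, key z hz0]
  simp only [norm_mul, norm_pow, norm_inv, hz1, inv_one, one_pow, one_mul]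
  have hm : t⁻¹ ∈ closure (Metric.ball (0 : ℂ) 1) := by
    apply subset_closure
    simp only [Metric.mem_ball, dist_zero_right, norm_inv]
    exact inv_lt_one_of_one_lt₀ ht
  have := hmax hm
  simp only [Set.mem_ofPred_eq] at this
  gcongr
  exact this

/-- Moving one coordinate into the disc without decreasing the weighted modulus. -/
lemma gaussW_step {n : ℕ} (δ : ℕ) (P : MvPolynomial (Fin n) ℂ) (hP : P.totalDegree ≤ δ)
    (z : Fin n → ℂ) (i : Fin n) :
    ∃ s : ℂ, ‖s‖ ≤ 1 ∧ gaussW δ P z ≤ gaussW δ P (Function.update z i s) := by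
  by_cases h : ‖z i‖ ≤ 1
  · exact ⟨z i, h, by simp⟩
  push Not at h
  let p : Polynomial ℂ :=
    MvPolynomial.aeval (Function.update (fun j => Polynomial.C (z j)) i Polynomial.X) P
  have hev : ∀ t, p.eval t = MvPolynomial.eval (Function.update z i t) P := by
    intro t
    change Polynomial.evalRingHom t _ = _
    simp only [p, MvPolynomial.aeval_def, MvPolynomial.eval]
    rw [← MvPolynomial.coe_eval₂Hom, ← RingHom.comp_apply, MvPolynomial.comp_eval₂Hom]
    congr 2
    · ext <;> simp
    · funext j
      by_cases hj : j = i
      · subst hj; simp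
      · simp [hj]
  have hdeg : p.natDegree ≤ δ := by
    have := MvPolynomial.aeval_natDegree_le P (n := 1) (m := δ) hP
      (Function.update (fun j => Polynomial.C (z j)) i Polynomial.X) (by
        intro j
        by_cases hj : j = i
        · subst hj; simp
        · simp [hj])
    simpa using this
  obtain ⟨s, hs, hle⟩ := poly_growth p δ hdeg (z i) h
  refine ⟨s, hs.le, ?_⟩
  rw [hev, hev, Function.update_eq_self] at hle
  unfold gaussW
  have e1 : ∑ j, ‖z j‖ ^ 2 = ‖z i‖ ^ 2 + ∑ j ∈ Finset.univ.erase i, ‖z j‖ ^ 2 :=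
    (Finset.add_sum_erase _ _ (Finset.mem_univ i)).symm
  have e2 : ∑ j, ‖Function.update z i s j‖ ^ 2
      = 1 + ∑ j ∈ Finset.univ.erase i, ‖z j‖ ^ 2 := by
    rw [← Finset.add_sum_erase _ _ (Finset.mem_univ i)]
    congr 1
    · simp [hs]
    · apply Finset.sum_congr rfl
      intro j hj
      rw [Function.update_of_ne (Finset.ne_of_mem_erase hj)]
  rw [e1, e2]
  set S := ∑ j ∈ Finset.univ.erase i, ‖z j‖ ^ 2
  set r := ‖z i‖
  have hr : 0 < r := by linarith
  have hpow : r ^ δ ≤ Real.exp ((δ / 2 : ℝ) * (r ^ 2 - 1)) := by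
    have h2 : r ≤ Real.exp ((r ^ 2 - 1) / 2) := by
      have := Real.add_one_le_exp ((r ^ 2 - 1) / 2)
      nlinarith [sq_nonneg (r - 1)]
    calc r ^ δ ≤ (Real.exp ((r ^ 2 - 1) / 2)) ^ δ := by gcongr
      _ = _ := by rw [← Real.exp_nat_mul]; congr 1; ring
  set A := ‖MvPolynomial.eval (Function.update z i s) P‖
  calc ‖MvPolynomial.eval z P‖ * Real.exp (-(δ / 2 : ℝ) * (r ^ 2 + S))
      ≤ (Real.exp ((δ / 2 : ℝ) * (r ^ 2 - 1)) * A) * Real.exp (-(δ / 2 : ℝ) * (r ^ 2 + S)) := by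
        gcongr
        refine hle.trans ?_
        gcongr
    _ = A * (Real.exp ((δ / 2 : ℝ) * (r ^ 2 - 1)) * Real.exp (-(δ / 2 : ℝ) * (r ^ 2 + S))) := by
        ring
    _ = _ := by rw [← Real.exp_add]; congr 2; ring

/-- The weighted modulus attains its global maximum in the closed polydisc. -/
lemma gaussW_max {n : ℕ} (δ : ℕ) (P : MvPolynomial (Fin n) ℂ) (hP : P.totalDegree ≤ δ) :
    ∃ a : Fin n → ℂ, (∀ j, ‖a j‖ ≤ 1) ∧ ∀ z, gaussW δ P z ≤ gaussW δ P a := by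
  have hK : IsCompact (Set.pi Set.univ fun _ : Fin n => Metric.closedBall (0 : ℂ) 1) :=
    isCompact_univ_pi fun _ => isCompact_closedBall _ _
  have hcont : Continuous (gaussW δ P) := by
    unfold gaussW
    have := MvPolynomial.continuous_eval P
    fun_prop
  obtain ⟨a, ha, hmax⟩ := hK.exists_isMaxOn ⟨0, by simp⟩ hcont.continuousOn
  refine ⟨a, fun j => by simpa using ha j (Set.mem_univ j), ?_⟩
  have main : ∀ s : Finset (Fin n), ∀ z : Fin n → ℂ, (∀ j, j ∉ s → ‖z j‖ ≤ 1) →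
      gaussW δ P z ≤ gaussW δ P a := by
    intro s
    induction s using Finset.induction_on with
    | empty =>
      intro z hz
      apply hmax
      intro j _
      simpa using hz j (by simp)
    | insert i s hi ih =>
      intro z hz
      obtain ⟨t, ht, hle⟩ := gaussW_step δ P hP z i
      refine hle.trans (ih _ ?_)
      intro j hj
      by_cases hji : j = i
      · subst hji; simpa using ht
      · rw [Function.update_of_ne hji]
        exact hz j (by simp [hji, hj])
  exact fun z => main Finset.univ z (by simp)

/-- Affine form of Lemma 3.4: there is `c_ℓ > 0` such that any nonzero polynomial of
degree `≤ δ` in `ℓ` variables avoids, at Euclidean distance `≥ c_ℓ δ^{-1/2}`, some point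
of the closed unit polydisc. -/
theorem stmt_4 (ℓ : ℕ) (hℓ : 1 ≤ ℓ) :
    ∃ c : ℝ, 0 < c ∧
      ∀ δ : ℕ, 1 ≤ δ →
      ∀ P : MvPolynomial (Fin ℓ) ℂ, P ≠ 0 → P.totalDegree ≤ δ →
      ∃ a : EuclideanSpace ℂ (Fin ℓ),
        (∀ j, ‖a j‖ ≤ 1) ∧
        ∀ z : EuclideanSpace ℂ (Fin ℓ),
          MvPolynomial.eval (fun j => z j) P = 0 → c / Real.sqrt δ ≤ dist a z := by
  refine ⟨1 / 4, by norm_num, ?_⟩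
  intro δ hδ P hP0 hP
  obtain ⟨a, ha, hmax⟩ := gaussW_max δ P hP
  refine ⟨WithLp.toLp 2 a, ha, ?_⟩
  intro z hz
  by_contra! hlt
  have hδ' : (0 : ℝ) < δ := by exact_mod_cast hδ
  have hPa : 0 < ‖MvPolynomial.eval a P‖ := by
    rw [norm_pos_iff]
    intro h0
    apply hP0
    apply MvPolynomial.funext
    intro x
    have := hmax x
    simp only [gaussW, h0, norm_zero, zero_mul] at this
    have h2 : ‖MvPolynomial.eval x P‖ ≤ 0 := nonpos_of_mul_nonpos_left this (Real.exp_pos _)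
    simpa using h2
  set w : Fin ℓ → ℂ := fun j => z j - a j with hw
  set D : ℝ := ∑ j, ‖w j‖ ^ 2 with hD
  have hD0 : 0 ≤ D := Finset.sum_nonneg fun _ _ => by positivity
  have hDlt : δ * D < 1 / 16 := by
    have e : dist (WithLp.toLp 2 a) z ^ 2 = D := by
      rw [dist_comm, EuclideanSpace.dist_eq, Real.sq_sqrt (Finset.sum_nonneg fun _ _ => by positivity)]
      simp [hD, hw, dist_eq_norm]
    have h1 : D < (1 / 4 / Real.sqrt δ) ^ 2 := by
      rw [← e]; gcongr
    rw [div_pow, Real.sq_sqrt hδ'.le, lt_div_iff₀ hδ'] at h1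
    linarith
  set B : ℂ := ∑ j, (starRingEnd ℂ) (a j) * w j with hB
  set g : ℂ → ℂ := fun t => MvPolynomial.eval (fun j => a j + t * w j) P *
    Complex.exp (-(δ : ℂ) * (t * B)) with hg
  have hg0 : g 0 = MvPolynomial.eval a P := by simp [hg]
  have hg1 : g 1 = 0 := by
    have : (fun j => a j + 1 * w j) = fun j => z j := by funext j; simp [hw]
    simp only [hg, this, hz, zero_mul]
  have hdiff : Differentiable ℂ g := by
    have h1 : Differentiable ℂ fun t : ℂ => MvPolynomial.eval (fun j => a j + t * w j) P := by
      have : ∀ Q : MvPolynomial (Fin ℓ) ℂ,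
          Differentiable ℂ fun t : ℂ => MvPolynomial.eval (fun j => a j + t * w j) Q := by
        intro Q
        induction Q using MvPolynomial.induction_on with
        | C c => simp
        | add p q hp hq => simp only [map_add]; exact hp.add hq
        | mul_X p i hp =>
          simp only [map_mul, MvPolynomial.eval_X]
          exact hp.mul (by fun_prop)
      exact this P
    exact h1.mul (by fun_prop)
  have hbound : ∀ t : ℂ, ‖g t‖ ≤ ‖g 0‖ * Real.exp (δ / 2 * (‖t‖ ^ 2 * D)) := by
    intro t
    have h := hmax (fun j => a j + t * w j)
    have hsum : ∑ j, ‖a j + t * w j‖ ^ 2 = ∑ j, ‖a j‖ ^ 2 + 2 * (t * B).re + ‖t‖ ^ 2 * D := by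
      rw [hB, hD, Finset.mul_sum, Finset.mul_sum, Complex.re_sum, Finset.mul_sum,
        ← Finset.sum_add_distrib, ← Finset.sum_add_distrib]
      apply Finset.sum_congr rfl
      intro j _
      simp only [← Complex.normSq_eq_norm_sq, Complex.normSq_apply, Complex.add_re,
        Complex.add_im, Complex.mul_re, Complex.mul_im, Complex.conj_re, Complex.conj_im]
      ring
    simp only [gaussW, hsum] at h
    set S := ∑ j, ‖a j‖ ^ 2
    set X := (t * B).re
    have hgt : ‖g t‖ = ‖MvPolynomial.eval (fun j => a j + t * w j) P‖ * Real.exp (-(δ : ℝ) * X) := by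
      simp only [hg, norm_mul, Complex.norm_exp]
      congr 2
      simp [X, Complex.mul_re]
    rw [hgt, hg0]
    set Y := ‖t‖ ^ 2 * D
    have h3 := mul_le_mul_of_nonneg_right h (Real.exp_pos (δ / 2 * (S + Y))).le
    rw [mul_assoc, mul_assoc, ← Real.exp_add, ← Real.exp_add] at h3
    have e1 : -(δ / 2 : ℝ) * (S + 2 * X + Y) + δ / 2 * (S + Y) = -(δ : ℝ) * X := by ring
    have e2 : -(δ / 2 : ℝ) * S + δ / 2 * (S + Y) = δ / 2 * Y := by ring
    rw [e1, e2] at h3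
    exact h3
  have hmaps : Set.MapsTo g (Metric.ball 0 4) (Metric.ball (g 0) (3 * ‖g 0‖)) := by
    intro t ht
    have ht4 : ‖t‖ < 4 := by simpa using ht
    rw [Metric.mem_ball, dist_eq_norm]
    have h1 := hbound t
    have hE : Real.exp (δ / 2 * (‖t‖ ^ 2 * D)) < 2 := by
      have h5 : ‖t‖ ^ 2 ≤ 16 := by nlinarith [norm_nonneg t]
      have h6 : (δ : ℝ) / 2 * (‖t‖ ^ 2 * D) ≤ 1 / 2 := by
        have : ‖t‖ ^ 2 * (δ * D) ≤ 16 * (δ * D) := by gcongr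
        nlinarith
      refine (Real.exp_le_exp.mpr h6).trans_lt ?_
      have h7 : Real.exp (1 / 2) * Real.exp (1 / 2) = Real.exp 1 := by
        rw [← Real.exp_add]; norm_num
      nlinarith [Real.exp_one_lt_d9, Real.exp_pos (1 / 2)]
    have hp : 0 < ‖g 0‖ := by rw [hg0]; exact hPa
    have := norm_sub_le (g t) (g 0)
    nlinarith
  have hs := Complex.dist_le_div_mul_dist_of_mapsTo_ball (z := 1) hdiff.differentiableOn (hmaps.mono_right Metric.ball_subset_closedBall) (by simp)
  rw [hg1, dist_zero_left] at hs
  simp only [dist_zero_right, norm_one, mul_one] at hs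
  have hp : 0 < ‖g 0‖ := by rw [hg0]; exact hPa
  linarith
end

section
/- Let m ≥ 1 and N ≥ 0 be integers and let F : ℂ^m → ℂ be an entire function, i.e. complex differentiable at every point of ℂ^m. Suppose there exists a constant C > 0 such that |F(w)| ≤ C (1 + ‖w‖)^N for all w ∈ ℂ^m. Then there exists a polynomial p in m complex variables with total degree at most N such that F(w) = p(w) for all w ∈ ℂ^m. -/
theorem aux_one (N : ℕ) (f : ℂ → ℂ) (hf : Differentiable ℂ f) (C : ℝ) (hC : 0 ≤ C)
    (h : ∀ z, ‖f z‖ ≤ C * (1 + ‖z‖) ^ N) :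
    ∃ p : Polynomial ℂ, p.natDegree ≤ N ∧ ∀ z, f z = p.eval z := by
  have hz : ∀ n, N < n → iteratedDeriv n f 0 = 0 := by
    intro n hn
    have key : ∀ R : ℝ, 1 ≤ R → ‖iteratedDeriv n f 0‖ ≤ (n.factorial * (C * 2 ^ N)) / R := by
      intro R hR
      have hR0 : 0 < R := by linarith
      have h1 := Complex.norm_iteratedDeriv_le_of_forall_mem_sphere_norm_le (c := 0) (R := R)
        (C := C * (2 * R) ^ N) (f := f) n hR0 hf.diffContOnCl (by
          intro z hz
          have : ‖z‖ = R := by simpa using hz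
          refine (h z).trans ?_
          rw [this]
          gcongr
          linarith)
      refine h1.trans ?_
      rw [div_le_div_iff₀ (by positivity) hR0]
      have h2 : R ^ (N + 1) ≤ R ^ n := pow_le_pow_right₀ hR hn
      calc n.factorial * (C * (2 * R) ^ N) * R
          = n.factorial * (C * 2 ^ N) * R ^ (N + 1) := by rw [mul_pow]; ring
        _ ≤ _ := by gcongr
    have hl : Filter.Tendsto (fun R : ℝ => (n.factorial * (C * 2 ^ N)) / R)
        Filter.atTop (nhds 0) := Filter.Tendsto.const_div_atTop Filter.tendsto_id _
    have h0 : ‖iteratedDeriv n f 0‖ ≤ 0 :=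
      ge_of_tendsto hl ((Filter.eventually_ge_atTop 1).mono key)
    exact norm_le_zero_iff.1 h0
  refine ⟨∑ n ∈ Finset.range (N + 1),
    Polynomial.C ((n.factorial : ℂ)⁻¹ * iteratedDeriv n f 0) * Polynomial.X ^ n, ?_, ?_⟩
  · refine Polynomial.natDegree_sum_le_of_forall_le _ _ ?_
    intro i hi
    refine (Polynomial.natDegree_C_mul_X_pow_le _ _).trans ?_
    have := Finset.mem_range.1 hi
    omega
  · intro z
    rw [← Complex.taylorSeries_eq_of_entire' 0 z hf, tsum_eq_sum (s := Finset.range (N + 1))]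
    · simp [Polynomial.eval_finsetSum]
    · intro n hn
      rw [hz n (by simpa using hn)]
      simp

theorem aux_poly (N : ℕ) : ∀ (m : ℕ) (F : (Fin m → ℂ) → ℂ)
    (_ : Differentiable ℂ F) (C : ℝ) (_ : 0 ≤ C)
    (_ : ∀ w : Fin m → ℂ, ‖F w‖ ≤ C * (1 + ‖w‖) ^ N),
    ∃ p : MvPolynomial (Fin m) ℂ, ∀ w, F w = MvPolynomial.eval w p := by
  intro m
  induction m with
  | zero =>
    intro F _ C _ _
    refine ⟨MvPolynomial.C (F 0), fun w => ?_⟩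
    rw [MvPolynomial.eval_C, Subsingleton.elim w 0]
  | succ m ih =>
    intro F hF C hC h
    have hb : ∀ (z : ℂ) (w : Fin m → ℂ),
        ‖F (Fin.cons z w : Fin (m + 1) → ℂ)‖ ≤ C * (1 + ‖z‖) ^ N * (1 + ‖w‖) ^ N := by
      intro z w
      refine (h _).trans ?_
      rw [mul_assoc, ← mul_pow]
      gcongr
      have : ‖(Fin.cons z w : Fin (m + 1) → ℂ)‖ ≤ ‖z‖ + ‖w‖ := by
        rw [pi_norm_le_iff_of_nonneg (by positivity)]
        intro i
        refine Fin.cases ?_ (fun j => ?_) i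
        · simp
        · simpa using (norm_le_pi_norm w j).trans (by simp)
      nlinarith [norm_nonneg z, norm_nonneg w, mul_nonneg (norm_nonneg z) (norm_nonneg w)]
    have hd1 : ∀ z : ℂ, Differentiable ℂ (fun w : Fin m → ℂ => F (Fin.cons z w : Fin (m + 1) → ℂ)) := by
      intro z
      refine hF.comp ?_
      rw [differentiable_pi]
      intro i
      refine Fin.cases ?_ (fun j => ?_) i
      · simp
      · simp only [Fin.cons_succ]; fun_prop
    have hd2 : ∀ w : Fin m → ℂ, Differentiable ℂ (fun z : ℂ => F (Fin.cons z w : Fin (m + 1) → ℂ)) := by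
      intro w
      refine hF.comp ?_
      rw [differentiable_pi]
      intro i
      refine Fin.cases ?_ (fun j => ?_) i
      · simp only [Fin.cons_zero]; fun_prop
      · simp
    have hq := fun z : ℂ => ih _ (hd1 z) (C * (1 + ‖z‖) ^ N) (by positivity) (hb z)
    choose q hq using hq
    let v : ℕ → ℂ := fun j => (j : ℂ)
    refine ⟨∑ j ∈ Finset.range (N + 1), MvPolynomial.rename Fin.succ (q (v j)) *
      Polynomial.aeval (MvPolynomial.X 0) (Lagrange.basis (Finset.range (N + 1)) v j), ?_⟩
    intro w
    obtain ⟨p, hp, hpe⟩ := aux_one N _ (hd2 (Fin.tail w)) (C * (1 + ‖Fin.tail w‖) ^ N)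
      (by positivity) (fun z => (hb z _).trans (le_of_eq (by ring)))
    have hi := Lagrange.eq_interpolate (s := Finset.range (N + 1)) (v := v) (f := p)
      (fun a _ b _ hab => by simpa [v] using hab) (by
        refine (Polynomial.degree_le_of_natDegree_le hp).trans_lt ?_
        simp only [Finset.card_range]
        exact_mod_cast Nat.lt_succ_self N)
    have h0 := hpe (w 0)
    simp only [Fin.cons_self_tail] at h0
    rw [h0, hi, Lagrange.interpolate_apply, Polynomial.eval_finsetSum, map_sum]
    refine Finset.sum_congr rfl fun j _ => ?_
    rw [Polynomial.eval_mul, Polynomial.eval_C, map_mul, MvPolynomial.eval_rename, ← hpe, hq]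
    congr 1
    have := Polynomial.hom_eval₂ (Lagrange.basis (Finset.range (N + 1)) v j)
      (algebraMap ℂ (MvPolynomial (Fin (m+1)) ℂ)) (MvPolynomial.eval w) (MvPolynomial.X 0)
    rw [Polynomial.aeval_def, this, MvPolynomial.eval_X]
    have h2 : (MvPolynomial.eval w).comp (algebraMap ℂ (MvPolynomial (Fin (m+1)) ℂ))
      = RingHom.id ℂ := by ext; simp
    rw [h2]; rfl

/-- Liouville theorem with polynomial growth in several variables: an entire function
on `ℂ^m` with `|F(w)| ≤ C (1 + ‖w‖)^N` is a polynomial of total degree at most `N`. -/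
theorem stmt_6 (m N : ℕ) (hm : 1 ≤ m) (F : (Fin m → ℂ) → ℂ)
    (hF : Differentiable ℂ F) (C : ℝ) (hC : 0 < C)
    (hgrowth : ∀ w : Fin m → ℂ, ‖F w‖ ≤ C * (1 + ‖w‖) ^ N) :
    ∃ p : MvPolynomial (Fin m) ℂ,
      p.totalDegree ≤ N ∧ ∀ w, F w = MvPolynomial.eval w p := by
  obtain ⟨P, hP⟩ := aux_poly N m F hF C hC.le hgrowth
  refine ⟨P, ?_, hP⟩
  by_contra hlt
  push Not at hlt
  have hzero : MvPolynomial.homogeneousComponent P.totalDegree P = 0 := by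
    apply MvPolynomial.funext
    intro w
    rw [map_zero]
    obtain ⟨p, hp, hpe⟩ := aux_one N (fun t : ℂ => F (t • w)) (hF.comp (by fun_prop))
      (C * (1 + ‖w‖) ^ N) (by positivity) (by
        intro t
        refine (hgrowth _).trans ?_
        rw [mul_assoc, ← mul_pow, norm_smul]
        gcongr
        nlinarith [norm_nonneg t, norm_nonneg w])
    let q : Polynomial ℂ := ∑ k ∈ Finset.range (P.totalDegree + 1),
      Polynomial.C (MvPolynomial.eval w (MvPolynomial.homogeneousComponent k P)) * Polynomial.X ^ k
    have hpq : p = q := by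
      apply Polynomial.funext
      intro t
      rw [← hpe, hP]
      conv_lhs => rw [← MvPolynomial.sum_homogeneousComponent P]
      simp only [q, map_sum, Polynomial.eval_finsetSum]
      refine Finset.sum_congr rfl fun k _ => ?_
      have hk := MvPolynomial.homogeneousComponent_isHomogeneous k P
      rw [Polynomial.eval_mul, Polynomial.eval_C, Polynomial.eval_pow, Polynomial.eval_X,
        MvPolynomial.eval_eq', MvPolynomial.eval_eq', Finset.sum_mul]
      refine Finset.sum_congr rfl fun d hd => ?_
      have hdk := hk (MvPolynomial.mem_support_iff.1 hd)
      have hs : ∑ i, d i = k := by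
        rw [← hdk, Finsupp.weight_apply, Finsupp.sum_fintype] <;> simp
      simp only [Pi.smul_apply, smul_eq_mul, mul_pow, Finset.prod_mul_distrib,
        Finset.prod_pow_eq_pow_sum, hs]
      ring
    have hc : q.coeff P.totalDegree = 0 := by
      rw [← hpq]
      exact Polynomial.coeff_eq_zero_of_natDegree_lt (hp.trans_lt hlt)
    simpa [q, Polynomial.finsetSum_coeff, Polynomial.coeff_C_mul, Polynomial.coeff_X_pow] using hc
  have hP0 : P ≠ 0 := by
    rintro rfl
    simp at hlt
  obtain ⟨d, hd, hde⟩ := Finset.exists_mem_eq_sup P.support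
    (MvPolynomial.support_nonempty.2 hP0) (fun s => s.sum fun _ e => e)
  have := congrArg (MvPolynomial.coeff d) hzero
  rw [MvPolynomial.coeff_homogeneousComponent, if_pos] at this
  · exact (MvPolynomial.mem_support_iff.1 hd) (by simpa using this)
  · exact hde.symm
end

section
/- Let X be a compact metric space and let μ and ν be Borel probability measures on X. Let 0 < ε ≤ 1 and suppose that for every bounded Lipschitz function φ : X → ℝ one has |∫ φ dμ − ∫ φ dν| ≤ ε (sup_X |φ| + Lip(φ)), where Lip(φ) denotes the Lipschitz constant of φ. Then for every 0 < α ≤ 1, every H > 0 and every function φ : X → ℝ satisfying |φ(x)| ≤ H for all x and |φ(x) − φ(y)| ≤ H d(x,y)^α for all x, y, one has |∫ φ dμ − ∫ φ dν| ≤ 4 H ε^α. -/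
open MeasureTheory

/-- Interpolation between Hölder classes (Section 6): a rate-`ε` equidistribution bound
against bounded Lipschitz test functions implies a rate-`ε^α` bound against `C^α`
test functions. -/
theorem stmt_7 {X : Type*} [MetricSpace X] [CompactSpace X]
    [MeasurableSpace X] [BorelSpace X]
    (μ ν : Measure X) [IsProbabilityMeasure μ] [IsProbabilityMeasure ν]
    (ε : ℝ) (hε0 : 0 < ε) (hε1 : ε ≤ 1)
    (hLip : ∀ (φ : X → ℝ) (B : ℝ) (L : NNReal), (∀ x, |φ x| ≤ B) →
      LipschitzWith L φ →
      |∫ x, φ x ∂μ - ∫ x, φ x ∂ν| ≤ ε * (B + (L : ℝ))) :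
    ∀ α : ℝ, 0 < α → α ≤ 1 → ∀ H : ℝ, 0 < H →
    ∀ φ : X → ℝ, (∀ x, |φ x| ≤ H) → (∀ x y, |φ x - φ y| ≤ H * dist x y ^ α) →
    |∫ x, φ x ∂μ - ∫ x, φ x ∂ν| ≤ 4 * H * ε ^ α := by
  intro α hα0 hα1 H hH φ hb hh
  have hne : Nonempty X := by
    by_contra h
    rw [not_nonempty_iff] at h
    have h1 : μ Set.univ = 1 := measure_univ
    rw [Set.univ_eq_empty_iff.2 h, measure_empty] at h1
    exact zero_ne_one h1
  set L : ℝ := H * ε ^ (α - 1) with hL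
  have hL0 : 0 ≤ L := by positivity
  have hεL : ε * L = H * ε ^ α := by
    rw [hL, Real.rpow_sub_one hε0.ne']
    field_simp
  have hεα : ε ≤ ε ^ α := by
    simpa using Real.rpow_le_rpow_of_exponent_ge hε0 hε1 hα1
  have key : ∀ d : ℝ, 0 ≤ d → H * d ^ α ≤ H * ε ^ α + L * d := by
    intro d hd
    rcases le_total d ε with h | h
    · have h1 : d ^ α ≤ ε ^ α := Real.rpow_le_rpow hd h hα0.le
      have h2 : 0 ≤ L * d := mul_nonneg hL0 hd
      nlinarith
    · have hdpos : 0 < d := lt_of_lt_of_le hε0 h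
      have h1 : d ^ (α - 1) ≤ ε ^ (α - 1) :=
        Real.rpow_le_rpow_of_nonpos hε0 h (by linarith)
      have h2 : d ^ α = d ^ (α - 1) * d := by
        rw [Real.rpow_sub_one hdpos.ne']; field_simp
      have h3 : 0 ≤ H * ε ^ α := by positivity
      have h4 : H * (d ^ (α - 1) * d) ≤ H * (ε ^ (α - 1) * d) := by gcongr
      rw [h2, hL]
      nlinarith
  let ψ : X → ℝ := fun x => ⨅ y, (φ y + L * dist x y)
  have hbdd : ∀ x, BddBelow (Set.range fun y => φ y + L * dist x y) := by
    intro x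
    refine ⟨-H, ?_⟩
    rintro _ ⟨y, rfl⟩
    have h1 := (abs_le.1 (hb y)).1
    have h2 : 0 ≤ L * dist x y := mul_nonneg hL0 dist_nonneg
    show -H ≤ φ y + L * dist x y
    linarith
  have hψle : ∀ x, ψ x ≤ φ x := by
    intro x
    have h := ciInf_le (hbdd x) x
    simpa using h
  have hψge : ∀ x, φ x - H * ε ^ α ≤ ψ x := by
    intro x
    refine le_ciInf fun y => ?_
    have h1 := (abs_le.1 (hh x y)).2
    have h2 := key (dist x y) dist_nonneg
    linarith
  have hψb : ∀ x, |ψ x| ≤ H := by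
    intro x
    refine abs_le.2 ⟨?_, (hψle x).trans (abs_le.1 (hb x)).2⟩
    refine le_ciInf fun y => ?_
    have h1 := (abs_le.1 (hb y)).1
    have h2 : 0 ≤ L * dist x y := mul_nonneg hL0 dist_nonneg
    linarith
  have hψL : LipschitzWith ⟨L, hL0⟩ ψ := by
    refine LipschitzWith.of_le_add_mul _ fun x z => ?_
    show ψ x ≤ ψ z + L * dist x z
    rw [← sub_le_iff_le_add]
    refine le_ciInf fun y => ?_
    have h1 : ψ x ≤ φ y + L * dist x y := ciInf_le (hbdd x) y
    have h2 := mul_le_mul_of_nonneg_left (dist_triangle x z y) hL0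
    linarith
  have hφc : Continuous φ := by
    rw [continuous_iff_continuousAt]
    intro x
    rw [ContinuousAt, tendsto_iff_dist_tendsto_zero]
    have hc : Continuous fun y => H * dist y x ^ α :=
      continuous_const.mul ((continuous_id.dist continuous_const).rpow_const
        fun _ => Or.inr hα0.le)
    have ht := hc.tendsto x
    simp only [dist_self, Real.zero_rpow hα0.ne', mul_zero] at ht
    exact squeeze_zero (fun _ => dist_nonneg)
      (fun y => by rw [Real.dist_eq]; exact hh y x) ht
  have happ : ∀ (m : Measure X) [IsProbabilityMeasure m],
      |∫ x, φ x ∂m - ∫ x, ψ x ∂m| ≤ H * ε ^ α := by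
    intro m _
    have i1 : Integrable φ m :=
      Integrable.of_bound hφc.aestronglyMeasurable H (Filter.Eventually.of_forall hb)
    have i2 : Integrable ψ m :=
      Integrable.of_bound hψL.continuous.aestronglyMeasurable H
        (Filter.Eventually.of_forall hψb)
    rw [← integral_sub i1 i2]
    have h := norm_integral_le_of_norm_le_const (μ := m) (f := fun x => φ x - ψ x)
      (C := H * ε ^ α) (Filter.Eventually.of_forall fun x => by
        rw [Real.norm_eq_abs, abs_of_nonneg (by linarith [hψle x])]
        linarith [hψge x])
    simpa using h
  have h1 := abs_le.1 (happ μ)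
  have h2 := abs_le.1 (happ ν)
  have h3 : |∫ x, ψ x ∂μ - ∫ x, ψ x ∂ν| ≤ ε * (H + L) := hLip ψ H ⟨L, hL0⟩ hψb hψL
  have h4 := abs_le.1 h3
  have h5 : ε * (H + L) ≤ 2 * (H * ε ^ α) := by nlinarith
  rw [abs_le]
  constructor <;> linarith [h1.1, h1.2, h2.1, h2.2, h4.1, h4.2]
end
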